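/- Let d ≥ 2, n and k_1, …, k_d be positive integers with k_1 + ⋯ + k_d = n, let F be a field, and let Π_1, …, Π_d be finite sets of affine k_1-, …, k_d-planes in F^n respectively. Let J = {p ∈ F^n : there exist π_j ∈ Π_j with δ(p, π_1, …, π_d) = 1} be the set of multijoints. There is a constant C = C(n), depending only on n, such that |J| ≤ C · ∏_{j=1}^d |Π_j|^{1/(d-1)}. -/

import Mathlib

namespace Multijoint

open MvPolynomial

section Translation
variable {F σ τ κ : Type*} [Field F]

/-- The translate `h(y + X)` of a polynomial `h(X)`. -/
noncomputable def translate (y : σ → F) : MvPolynomial σ F →ₐ[F] MvPolynomial σ F :=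
  aeval fun s => X s + C (y s)

@[simp] lemma translate_X (y : σ → F) (s : σ) : translate y (X s) = X s + C (y s) := by
  simp [translate]

@[simp] lemma translate_C (y : σ → F) (c : F) : translate y (C c) = C c := by
  simp [translate, algebraMap_eq]

lemma translate_zero (h : MvPolynomial σ F) : translate 0 h = h := by
  have : (translate 0 : MvPolynomial σ F →ₐ[F] _) = AlgHom.id F _ := by
    ext s; simp
  rw [this]; rfl

lemma translate_rename (e : κ → σ) (z : σ → F) (h : MvPolynomial κ F) :
    translate z (rename e h) = rename e (translate (z ∘ e) h) := by
  have : (translate z).comp (rename e) = (rename e).comp (translate (z ∘ e)) := by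
    ext s; simp
  exact DFunLike.congr_fun this h

/-- Substituting polynomials of degree at most one does not raise the total degree. -/
lemma totalDegree_aeval_le_of_forall_le_one (f : σ → MvPolynomial τ F)
    (hf : ∀ s, (f s).totalDegree ≤ 1) (h : MvPolynomial σ F) :
    (aeval f h).totalDegree ≤ h.totalDegree := by
  rw [aeval_def, eval₂_eq]
  refine totalDegree_finsetSum_le fun m hm => ?_
  refine (totalDegree_mul _ _).trans ?_
  rw [algebraMap_eq, totalDegree_C, zero_add]
  refine (totalDegree_finsetProd _ _).trans ((Finset.sum_le_sum fun s _ => ?_).trans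
    (le_totalDegree hm))
  refine (totalDegree_pow _ _).trans ?_
  simpa using Nat.mul_le_mul_left (m s) (hf s)

lemma totalDegree_X_add_C_le (s : σ) (c : F) : (X s + C c : MvPolynomial σ F).totalDegree ≤ 1 :=
  (totalDegree_add _ _).trans (by simp [totalDegree_X])

lemma totalDegree_translate_le (y : σ → F) (h : MvPolynomial σ F) :
    (translate y h).totalDegree ≤ h.totalDegree :=
  totalDegree_aeval_le_of_forall_le_one _ (fun s => totalDegree_X_add_C_le s (y s)) h

/-- Substitution of polynomials without constant term does not lower the order at the origin. -/
lemma aeval_mem_pow_idealOfVars (f : σ → MvPolynomial τ F) (hf : ∀ s, f s ∈ idealOfVars τ F)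
    {v : ℕ} {h : MvPolynomial σ F} (hh : h ∈ idealOfVars σ F ^ v) :
    aeval f h ∈ idealOfVars τ F ^ v := by
  have h1 : (idealOfVars σ F ^ v).map (aeval f : MvPolynomial σ F →ₐ[F] _) ≤
      idealOfVars τ F ^ v := by
    rw [Ideal.map_pow]
    refine Ideal.pow_right_mono ?_ v
    rw [idealOfVars, Ideal.map_span, Ideal.span_le]
    rintro _ ⟨_, ⟨s, rfl⟩, rfl⟩
    simpa using hf s
  exact h1 (Ideal.mem_map_of_mem _ hh)

lemma mem_idealOfVars_of_constantCoeff_eq_zero {h : MvPolynomial σ F}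
    (hh : constantCoeff h = 0) : h ∈ idealOfVars σ F := by
  rw [← pow_one (idealOfVars σ F), mem_pow_idealOfVars_iff']
  intro m hm
  have : m = 0 := (Finsupp.degree_eq_zero_iff m).1 (by omega)
  simpa [this, constantCoeff_eq] using hh

/-- If `P` has order at least `deg m` at the origin, then the coefficient at `m` of `P * Q`
is that of `P` times the constant term of `Q`. -/
lemma coeff_mul_of_mem_pow {P Q : MvPolynomial σ F} {m : σ →₀ ℕ}
    (hP : P ∈ idealOfVars σ F ^ m.degree) :
    coeff m (P * Q) = coeff m P * constantCoeff Q := by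
  classical
  rw [mem_pow_idealOfVars_iff'] at hP
  rw [coeff_mul, Finset.sum_eq_single (m, 0)]
  · rfl
  · rintro ⟨u, v⟩ huv hne
    rw [Finset.HasAntidiagonal.mem_antidiagonal] at huv
    simp only at huv ⊢
    rw [hP u, zero_mul]
    have hv : v ≠ 0 := by rintro rfl; simp_all
    have : 0 < v.degree := by
      rw [Nat.pos_iff_ne_zero, Ne, Finsupp.degree_eq_zero_iff]; exact hv
    have h2 := congrArg Finsupp.degree huv
    rw [map_add] at h2
    omega
  · intro h; simp [Finset.HasAntidiagonal.mem_antidiagonal] at h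

/-- Extracting from `G` the coefficient of a fixed monomial `ρ` in the variables outside the range
of `e` commutes with translations in the direction of the variables in the range of `e`. -/
lemma exists_slice (e : κ → σ) (he : Function.Injective e) (ρ : σ →₀ ℕ) (hρ : ∀ s, ρ (e s) = 0)
    (G : MvPolynomial σ F) :
    ∃ H : MvPolynomial κ F, ∀ z : σ → F, (∀ s, s ∉ Set.range e → z s = 0) → ∀ γ : κ →₀ ℕ,
      coeff γ (translate (z ∘ e) H) = coeff (γ.mapDomain e + ρ) (translate z G) := by
  classical
  induction G using MvPolynomial.induction_on' with
  | add p q hp hq =>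
    obtain ⟨H₁, h₁⟩ := hp
    obtain ⟨H₂, h₂⟩ := hq
    exact ⟨H₁ + H₂, fun z hz γ => by simp [h₁ z hz γ, h₂ z hz γ]⟩
  | monomial m c =>
    set μ : κ →₀ ℕ := m.comapDomain e he.injOn with hμ
    set m₀ : σ →₀ ℕ := m.filter (· ∉ Set.range e) with hm₀
    have hm : m = μ.mapDomain e + m₀ := by
      ext s
      by_cases hs : s ∈ Set.range e
      · obtain ⟨t, rfl⟩ := hs
        simp [hm₀, hμ, Finsupp.mapDomain_apply he]
      · rw [Finsupp.add_apply, Finsupp.mapDomain_of_notMem_range _ _ hs, hm₀,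
          Finsupp.filter_apply_pos (· ∉ Set.range e) _ hs, zero_add]
    have hm₀e : ∀ s, m₀ (e s) = 0 := fun s => by simp [hm₀]
    have htr : ∀ z : σ → F, (∀ s, s ∉ Set.range e → z s = 0) →
        translate z (monomial m c) =
          rename e (translate (z ∘ e) (monomial μ c)) * monomial m₀ 1 := by
      intro z hz
      have h1 : (monomial m c : MvPolynomial σ F) = rename e (monomial μ c) * monomial m₀ 1 := by
        rw [rename_monomial, monomial_mul, mul_one, ← hm]
      rw [h1, map_mul, translate_rename]
      congr 1
      rw [translate, aeval_monomial, map_one, one_mul, monomial_eq, C_1, one_mul]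
      refine Finsupp.prod_congr fun s hs => ?_
      rw [hz s, C_0, add_zero]
      rintro ⟨t, rfl⟩
      exact (Finsupp.mem_support_iff.1 hs) (hm₀e t)
    by_cases hmρ : m₀ = ρ
    · refine ⟨monomial μ c, fun z hz γ => ?_⟩
      rw [htr z hz, hmρ, coeff_mul_monomial, mul_one, coeff_rename_mapDomain e he]
    · refine ⟨0, fun z hz γ => ?_⟩
      rw [htr z hz, map_zero, coeff_zero, coeff_mul_monomial', eq_comm, ite_eq_right_iff]
      intro hle
      rw [mul_one]
      refine coeff_rename_eq_zero _ _ _ fun u hu => absurd ?_ hmρ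
      have hu' : u.mapDomain e + m₀ = γ.mapDomain e + ρ := by
        rw [hu, tsub_add_cancel_of_le hle]
      ext s
      by_cases hs : s ∈ Set.range e
      · obtain ⟨t, rfl⟩ := hs
        rw [hm₀e, hρ]
      · have := DFunLike.congr_fun hu' s
        rwa [Finsupp.add_apply, Finsupp.add_apply, Finsupp.mapDomain_of_notMem_range _ _ hs,
          Finsupp.mapDomain_of_notMem_range _ _ hs, zero_add, zero_add] at this

end Translation

section Chosen
variable {F ι κ : Type*} [Field F]

/-- The priority of the coefficient at the monomial `γ` at the point `a`, for handicaps `α`;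
coefficients are processed in increasing order of priority. -/
noncomputable def priority (α : ι → ℕ) (a : ι) (γ : κ →₀ ℕ) : ℤ ×ₗ (ι ×ₗ Lex (κ →₀ ℕ)) :=
  toLex ((γ.degree : ℤ) - α a, toLex (a, toLex γ))

lemma priority_injective {α : ι → ℕ} {a b : ι} {γ γ' : κ →₀ ℕ}
    (h : priority α a γ = priority α b γ') : a = b ∧ γ = γ' := by
  have := congrArg (fun z => (ofLex (ofLex z).2)) h
  simp only [priority, ofLex_toLex, Prod.mk.injEq, EmbeddingLike.apply_eq_iff_eq] at this
  exact this

variable [LinearOrder ι] [LinearOrder κ]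

lemma priority_lt_iff {α : ι → ℕ} {a b : ι} {γ γ' : κ →₀ ℕ} :
    priority α b γ' < priority α a γ ↔ γ'.degree + α a < γ.degree + α b ∨
      (γ'.degree + α a = γ.degree + α b ∧ (b < a ∨ (b = a ∧ toLex γ' < toLex γ))) := by
  simp only [priority, Prod.Lex.toLex_lt_toLex]
  have h1 : (γ'.degree : ℤ) - α b < γ.degree - α a ↔ γ'.degree + α a < γ.degree + α b := by omega
  have h2 : (γ'.degree : ℤ) - α b = γ.degree - α a ↔ γ'.degree + α a = γ.degree + α b := by omega
  rw [h1, h2]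

/-- The monomials `γ` whose coefficient at the point `a` is independent, on polynomials of degree
at most `D`, of all coefficients at points of `S` of lower priority. -/
def chosen (S : Set ι) (y : ι → κ → F) (α : ι → ℕ) (D : ℕ) (a : ι) : Set (κ →₀ ℕ) :=
  {γ | ∃ h : MvPolynomial κ F, h.totalDegree ≤ D ∧ coeff γ (translate (y a) h) ≠ 0 ∧
    ∀ b ∈ S, ∀ γ', priority α b γ' < priority α a γ → coeff γ' (translate (y b) h) = 0}

lemma degree_le_totalDegree_of_coeff_ne_zero {σ : Type*} {h : MvPolynomial σ F} {m : σ →₀ ℕ}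
    (hm : coeff m h ≠ 0) : m.degree ≤ h.totalDegree := by
  have := le_totalDegree (mem_support_iff.2 hm)
  rwa [Finsupp.degree_apply]

lemma degree_le_of_mem_chosen {S : Set ι} {y : ι → κ → F} {α : ι → ℕ} {D : ℕ} {a : ι}
    {γ : κ →₀ ℕ} (hγ : γ ∈ chosen S y α D a) : γ.degree ≤ D := by
  obtain ⟨h, hD, hne, -⟩ := hγ
  exact (degree_le_totalDegree_of_coeff_ne_zero hne).trans
    ((totalDegree_translate_le _ _).trans hD)

lemma finite_setOf_forall_le (κ : Type*) [Finite κ] (D : ℕ) : {γ : κ →₀ ℕ | ∀ i, γ i ≤ D}.Finite :=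
  (Set.Finite.pi' fun _ => Set.finite_le_nat D).preimage DFunLike.coe_injective.injOn

lemma ncard_setOf_forall_le (κ : Type*) [Fintype κ] (D : ℕ) :
    {γ : κ →₀ ℕ | ∀ i, γ i ≤ D}.ncard = (D + 1) ^ Fintype.card κ := by
  classical
  have h : {γ : κ →₀ ℕ | ∀ i, γ i ≤ D} =
      Finsupp.equivFunOnFinite.symm '' (Fintype.piFinset fun _ : κ => Finset.range (D + 1)) := by
    ext γ
    rw [Equiv.image_eq_preimage_symm]
    simp
  rw [h, Set.ncard_image_of_injective _ (Equiv.injective _), Set.ncard_coe_finset]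
  simp

lemma finite_chosen [Finite κ] (S : Set ι) (y : ι → κ → F) (α : ι → ℕ) (D : ℕ) (a : ι) :
    (chosen S y α D a).Finite :=
  (finite_setOf_forall_le κ D).subset fun _ hγ i =>
    (Finsupp.le_degree i _).trans (degree_le_of_mem_chosen hγ)

lemma chosen_subset_of_le {S : Set ι} {y : ι → κ → F} {α β : ι → ℕ} {D : ℕ} {a : ι}
    (h : α ≤ β) (ha : α a = β a) : chosen S y β D a ⊆ chosen S y α D a := by
  rintro γ ⟨w, hD, hne, hw⟩
  refine ⟨w, hD, hne, fun b hb γ' hlt => hw b hb γ' ?_⟩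
  rw [priority_lt_iff] at hlt ⊢
  have : α b ≤ β b := h b
  rcases hlt with hlt | ⟨heq, hlt⟩
  · left; omega
  · rcases this.lt_or_eq with h1 | h1
    · left; omega
    · right; exact ⟨by omega, hlt⟩

/-- Raising the handicap of `a` by one can be compensated by raising the degree. -/
lemma chosen_update_subset [Fintype ι] {S : Set ι} {y : ι → κ → F} (hy : S.InjOn y) {α : ι → ℕ}
    {D : ℕ} {a : ι} (ha : a ∈ S) :
    chosen S y (Function.update α a (α a + 1)) D a ⊆ chosen S y α (D + Fintype.card ι) a := by
  classical
  rintro γ ⟨w, hD, hne, hw⟩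
  have hsep : ∀ b : ι, ∃ s : Option κ, b ∈ S → b ≠ a → ∃ t, s = some t ∧ y b t ≠ y a t := by
    intro b
    by_cases h : b ∈ S ∧ b ≠ a
    · have : y b ≠ y a := fun e => h.2 (hy h.1 ha e)
      obtain ⟨t, ht⟩ := Function.ne_iff.1 this
      exact ⟨some t, fun _ _ => ⟨t, rfl, ht⟩⟩
    · exact ⟨none, fun h1 h2 => absurd ⟨h1, h2⟩ h⟩
  choose s hs using hsep
  let ℓ : ι → MvPolynomial κ F := fun b => (s b).elim 1 fun t => X t + C (-y b t)
  let U : Finset ι := Finset.univ.filter fun b => b ∈ S ∧ b ≠ a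
  have hℓdeg : ∀ b, (ℓ b).totalDegree ≤ 1 := by
    intro b
    rcases h : s b with _ | t
    · simp [ℓ, h]
    · simp only [ℓ, h, Option.elim]
      exact totalDegree_X_add_C_le t _
  have hℓtr : ∀ b ∈ U, ∀ c, ∃ t, y b t ≠ y a t ∧
      constantCoeff (translate (y c) (ℓ b)) = y c t - y b t := by
    intro b hb c
    simp only [U, Finset.mem_filter, Finset.mem_univ, true_and] at hb
    obtain ⟨t, ht, hne⟩ := hs b hb.1 hb.2
    refine ⟨t, hne, ?_⟩
    simp [ℓ, ht, sub_eq_add_neg]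
  refine ⟨w * ∏ b ∈ U, ℓ b, ?_, ?_, ?_⟩
  · refine (totalDegree_mul _ _).trans (add_le_add hD ?_)
    refine (totalDegree_finsetProd _ _).trans ((Finset.sum_le_card_nsmul _ _ 1
      fun b _ => hℓdeg b).trans ?_)
    simpa using Finset.card_le_univ U
  · rw [map_mul, coeff_mul_of_mem_pow]
    · refine mul_ne_zero hne ?_
      rw [map_prod, map_prod, Finset.prod_ne_zero_iff]
      intro b hb
      obtain ⟨t, ht, h⟩ := hℓtr b hb a
      rw [h, sub_ne_zero]
      exact ht.symm
    · rw [mem_pow_idealOfVars_iff']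
      intro m hm
      refine hw a ha m ?_
      rw [priority_lt_iff]
      left; omega
  · intro b hb γ' hlt
    rw [priority_lt_iff] at hlt
    rw [map_mul]
    by_cases hba : b = a
    · subst hba
      have key : translate (y b) w ∈ idealOfVars κ F ^ γ'.degree := by
        rw [mem_pow_idealOfVars_iff']
        intro m hm
        refine hw b hb m ?_
        rw [priority_lt_iff]
        left; omega
      rw [coeff_mul_of_mem_pow key, hw b hb γ', zero_mul]
      rw [priority_lt_iff]
      simpa using hlt
    · have hbU : b ∈ U := by simp [U, hb, hba]
      rw [← Finset.mul_prod_erase _ _ hbU, map_mul, ← mul_assoc]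
      have h1 : translate (y b) (ℓ b) ∈ idealOfVars κ F := by
        apply mem_idealOfVars_of_constantCoeff_eq_zero
        obtain ⟨t, -, h⟩ := hℓtr b hbU b
        rw [h, sub_self]
      have h2 : translate (y b) w ∈ idealOfVars κ F ^ γ'.degree := by
        rw [mem_pow_idealOfVars_iff']
        intro m hm
        refine hw b hb m ?_
        rw [priority_lt_iff, Function.update_self, Function.update_of_ne hba]
        rcases hlt with hlt | ⟨heq, hlt | ⟨hlt, -⟩⟩
        · left; omega
        · rcases (show m.degree + (α a + 1) ≤ γ.degree + α b by omega).lt_or_eq with h | h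
          · exact Or.inl h
          · exact Or.inr ⟨h, Or.inl hlt⟩
        · exact absurd hlt hba
      have h3 : translate (y b) w * translate (y b) (ℓ b) *
          translate (y b) (∏ c ∈ U.erase b, ℓ c) ∈ idealOfVars κ F ^ (γ'.degree + 1) := by
        rw [pow_succ]
        exact Ideal.mul_mem_right _ _ (Ideal.mul_mem_mul h2 h1)
      rw [mem_pow_idealOfVars_iff'] at h3
      exact h3 γ' (Nat.lt_succ_self _)

/-- The total number of chosen coefficients is at most the dimension of the space of polynomials. -/
lemma sum_ncard_chosen_le [Fintype κ] (S : Finset ι) (y : ι → κ → F) (α : ι → ℕ) (D : ℕ) :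
    ∑ a ∈ S, (chosen (S : Set ι) y α D a).ncard ≤ (D + 1) ^ Fintype.card κ := by
  classical
  let E : Finset (Σ _ : ι, κ →₀ ℕ) := S.sigma fun a => (finite_chosen (S : Set ι) y α D a).toFinset
  have hE : ∀ e : E, e.1.1 ∈ S ∧ e.1.2 ∈ chosen (S : Set ι) y α D e.1.1 := by
    rintro ⟨e, he⟩
    simpa [E] using he
  choose w hwD hwne hw using fun e : E => (hE e).2
  have hmem : ∀ e, w e ∈ restrictDegree κ F D := fun e =>
    restrictTotalDegree_le_restrictDegree κ F D ((mem_restrictTotalDegree κ D _).2 (hwD e))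
  have hli : LinearIndependent F fun e : E => (⟨w e, hmem e⟩ : restrictDegree κ F D) := by
    rw [linearIndependent_iff']
    intro s c hc
    by_contra! hcon
    obtain ⟨e₀, he₀, hmin⟩ := Finset.exists_min_image (s.filter fun e => c e ≠ 0)
      (fun e => priority α e.1.1 e.1.2) (by
        obtain ⟨i, hi, hi'⟩ := hcon
        exact ⟨i, by simp [hi, hi']⟩)
    rw [Finset.mem_filter] at he₀
    have h1 : ∑ e ∈ s, c e • w e = 0 := by
      simpa using congrArg Subtype.val hc
    have h2 := congrArg (fun p => coeff e₀.1.2 (translate (y e₀.1.1) p)) h1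
    simp only [map_sum, map_smul, coeff_sum, coeff_smul, map_zero, coeff_zero] at h2
    rw [Finset.sum_eq_single_of_mem e₀ he₀.1] at h2
    · exact (mul_ne_zero he₀.2 (hwne e₀)) h2
    · intro e he hne
      by_cases hce : c e = 0
      · rw [hce, zero_smul]
      · rw [hw e e₀.1.1 (hE e₀).1 e₀.1.2, smul_zero]
        refine lt_of_le_of_ne (hmin e (Finset.mem_filter.2 ⟨he, hce⟩)) fun heq => hne ?_
        obtain ⟨h1, h2⟩ := priority_injective heq
        exact Subtype.ext (Sigma.ext h1.symm (heq_of_eq h2.symm))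
  have h1 := hli.fintype_card_le_finrank
  have h2 : Module.finrank F (restrictDegree κ F D) = (D + 1) ^ Fintype.card κ := by
    rw [← ncard_setOf_forall_le, restrictDegree,
      Module.finrank_eq_nat_card_basis (basisRestrictSupport F _)]
    rfl
  rw [h2, Fintype.card_coe, Finset.card_sigma] at h1
  refine le_trans (le_of_eq (Finset.sum_congr rfl fun a _ => ?_)) h1
  exact Set.ncard_eq_toFinset_card _ _

end Chosen

section Vanishing
variable {F σ τ υ : Type*} [Field F] [Fintype τ] [Fintype υ]

/-- The polynomial `g(q + M X)`. -/
noncomputable def expand (q : σ → F) (M : Matrix σ τ F) : MvPolynomial σ F →ₐ[F] MvPolynomial τ F :=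
  aeval fun i => C (q i) + ∑ s, C (M i s) * X s

lemma totalDegree_expand_le (q : σ → F) (M : Matrix σ τ F) (g : MvPolynomial σ F) :
    (expand q M g).totalDegree ≤ g.totalDegree := by
  refine totalDegree_aeval_le_of_forall_le_one _ (fun i => ?_) g
  refine (totalDegree_add _ _).trans (max_le (by simp) (totalDegree_finsetSum_le fun s _ => ?_))
  refine (totalDegree_mul _ _).trans ?_
  simp [totalDegree_X]

lemma translate_expand (q : σ → F) (M : Matrix σ τ F) (z : τ → F) (g : MvPolynomial σ F) :
    translate z (expand q M g) = expand (q + M.mulVec z) M g := by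
  have : (translate z).comp (expand q M) = expand (q + M.mulVec z) M := by
    ext1 i
    simp only [AlgHom.comp_apply, expand, aeval_X, map_add, map_sum, map_mul, translate_C,
      translate_X, mul_add, Finset.sum_add_distrib, Pi.add_apply, Matrix.mulVec, dotProduct]
    abel
  exact DFunLike.congr_fun this g

lemma aeval_expand (q : σ → F) (M : Matrix σ τ F) (L : Matrix τ υ F) (g : MvPolynomial σ F) :
    aeval (fun s => ∑ t, C (L s t) * X t) (expand q M g) = expand q (M * L) g := by
  have : (aeval (fun s => ∑ t, C (L s t) * X t)).comp (expand q M) = expand q (M * L) := by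
    ext1 i
    simp only [AlgHom.comp_apply, expand, aeval_X, map_add, map_sum, map_mul, aeval_C,
      algebraMap_eq, Matrix.mul_apply, Finset.mul_sum, Finset.sum_mul]
    rw [Finset.sum_comm]
    simp only [mul_assoc]
  exact DFunLike.congr_fun this g

lemma expand_injective [Fintype σ] [DecidableEq σ] (q : σ → F) (M : Matrix σ τ F)
    (B : Matrix τ σ F) (h : M * B = 1) : Function.Injective (expand q M) := by
  have : (aeval fun i => X i + C (-q i)).comp ((aeval fun s => ∑ t, C (B s t) * X t).comp
      (expand q M)) = AlgHom.id F (MvPolynomial σ F) := by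
    ext1 i
    simp only [AlgHom.comp_apply, aeval_expand, h]
    simp [expand, Matrix.one_apply]
  intro g g' hg
  have h1 := DFunLike.congr_fun this g
  have h2 := DFunLike.congr_fun this g'
  simp only [AlgHom.comp_apply, AlgHom.id_apply] at h1 h2
  rw [← h1, ← h2, hg]

/-- A lower bound on the order at the origin of `g(q + M X)` does not depend on the frame `M`. -/
lemma expand_mem_pow_of_right_inverse [Fintype σ] [DecidableEq σ] {q : σ → F} {M : Matrix σ τ F}
    {B : Matrix τ σ F} (h : M * B = 1) {v : ℕ} {g : MvPolynomial σ F}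
    (hg : expand q M g ∈ idealOfVars τ F ^ v) (M' : Matrix σ υ F) :
    expand q M' g ∈ idealOfVars υ F ^ v := by
  have h1 : expand q M' g = aeval (fun s => ∑ t, C ((B * M') s t) * X t) (expand q M g) := by
    rw [aeval_expand, ← Matrix.mul_assoc, h, Matrix.one_mul]
  rw [h1]
  refine aeval_mem_pow_idealOfVars _ (fun s => ?_) hg
  apply mem_idealOfVars_of_constantCoeff_eq_zero
  simp

variable {ι J : Type*} [LinearOrder ι] [Fintype J] [LinearOrder J]
  {κ : J → Type*} [∀ j, Fintype (κ j)] [∀ j, LinearOrder (κ j)]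
  [Fintype σ] [DecidableEq σ]

/-- A nonzero polynomial has a nonzero coefficient, at a point of a dominating set `T`, all of whose
blocks are chosen. -/
lemma exists_coeff_ne_zero_of_chosen (q : ι → σ → F) (M : ι → Matrix σ (Σ j, κ j) F)
    (B : ι → Matrix (Σ j, κ j) σ F) (hMB : ∀ a, M a * B a = 1)
    (y : ∀ j, ι → κ j → F) (S : J → ι → Set ι) (hS : ∀ j a, a ∈ S j a)
    (hq : ∀ j a, ∃ o : σ → F, ∀ b ∈ S j a,
      q b = o + (M a).mulVec fun s => Pi.single (M := fun j => κ j → F) j (y j b) s.1 s.2)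
    (α : ι → ℕ) (D : ℕ) (T : Finset ι) (hT : T.Nonempty) (hdom : ∀ a ∈ T, ∀ b ∉ T, α b + D < α a)
    (g : MvPolynomial σ F) (hg : g ≠ 0) (hgD : g.totalDegree ≤ D) :
    ∃ a ∈ T, ∃ m : (Σ j, κ j) →₀ ℕ, coeff m (expand (q a) (M a) g) ≠ 0 ∧
      ∀ j, Finsupp.sigmaFinsuppEquivPiFinsupp m j ∈ chosen (S j a) (y j) α D a := by
  classical
  let key : (Σ _ : ι, (Σ j, κ j) →₀ ℕ) → ℤ ×ₗ (ι ×ₗ Lex (∀ j, Lex (κ j →₀ ℕ))) := fun e =>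
    toLex ((e.2.degree : ℤ) - α e.1, toLex (e.1, toLex fun j =>
      toLex (Finsupp.sigmaFinsuppEquivPiFinsupp e.2 j)))
  let E : Finset (Σ _ : ι, (Σ j, κ j) →₀ ℕ) := T.sigma fun a => (expand (q a) (M a) g).support
  have hE : E.Nonempty := by
    obtain ⟨a, ha⟩ := hT
    have : expand (q a) (M a) g ≠ 0 := by
      rw [Ne, ← map_zero (expand (q a) (M a)), (expand_injective _ _ _ (hMB a)).eq_iff]
      exact hg
    obtain ⟨m, hm⟩ := support_nonempty.2 this
    exact ⟨⟨a, m⟩, Finset.mem_sigma.2 ⟨ha, hm⟩⟩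
  obtain ⟨⟨a, m⟩, ham, hmin⟩ := Finset.exists_min_image E key hE
  obtain ⟨haT, hm⟩ := Finset.mem_sigma.1 ham
  simp only [mem_support_iff] at haT hm
  have hmin' : ∀ b ∈ T, ∀ m', key ⟨b, m'⟩ < key ⟨a, m⟩ →
      coeff m' (expand (q b) (M b) g) = 0 := by
    intro b hb m' hlt
    by_contra hne
    exact (hmin ⟨b, m'⟩ (Finset.mem_sigma.2 ⟨hb, mem_support_iff.2 hne⟩)).not_gt hlt
  have hmD : m.degree ≤ D := (degree_le_totalDegree_of_coeff_ne_zero hm).trans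
    ((totalDegree_expand_le _ _ _).trans hgD)
  refine ⟨a, haT, m, hm, fun j => ?_⟩
  obtain ⟨o, ho⟩ := hq j a
  set γ := Finsupp.sigmaFinsuppEquivPiFinsupp m j with hγ
  let ρ : (Σ j, κ j) →₀ ℕ := m.filter fun s => s.1 ≠ j
  have hinj : Function.Injective (Sigma.mk j : κ j → Σ j, κ j) := sigma_mk_injective
  have hrange : ∀ s : Σ j, κ j, s ∉ Set.range (Sigma.mk j : κ j → Σ j, κ j) ↔ s.1 ≠ j := by
    rintro ⟨i, t⟩
    simp only [Set.range_sigmaMk, Set.mem_preimage, Set.mem_singleton_iff, ne_eq]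
  have hsplit : m = γ.mapDomain (Sigma.mk j) + ρ := by
    ext s
    by_cases hs : s.1 = j
    · obtain ⟨i, t⟩ := s
      obtain rfl : i = j := hs
      rw [Finsupp.add_apply, Finsupp.mapDomain_apply hinj]
      simp [ρ, γ]
    · rw [Finsupp.add_apply, Finsupp.mapDomain_of_notMem_range _ _ ((hrange s).2 hs)]
      simp [ρ, hs]
  have hρ : ∀ t, ρ ⟨j, t⟩ = 0 := fun t => by simp [ρ]
  have hupd : ∀ γ' : κ j →₀ ℕ, Finsupp.sigmaFinsuppEquivPiFinsupp (γ'.mapDomain (Sigma.mk j) + ρ) =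
      Function.update (Finsupp.sigmaFinsuppEquivPiFinsupp m) j γ' := by
    intro γ'
    funext i
    ext t
    rw [Finsupp.sigmaFinsuppEquivPiFinsupp_apply, Finsupp.add_apply]
    by_cases hi : i = j
    · subst hi
      rw [Finsupp.mapDomain_apply hinj, hρ, Function.update_self, add_zero]
    · rw [Finsupp.mapDomain_of_notMem_range _ _ ((hrange ⟨i, t⟩).2 hi), Function.update_of_ne hi]
      simp [ρ, hi]
  have hdeg : ∀ γ' : κ j →₀ ℕ,
      (γ'.mapDomain (Sigma.mk j) + ρ).degree = γ'.degree + ρ.degree := by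
    intro γ'
    rw [map_add, Finsupp.degree_mapDomain]
  have hdm : m.degree = γ.degree + ρ.degree := by rw [← hdeg, ← hsplit]
  obtain ⟨H, hH⟩ := exists_slice (Sigma.mk j) hinj ρ hρ (expand o (M a) g)
  have hHb : ∀ b ∈ S j a, ∀ γ', coeff γ' (translate (y j b) H) =
      coeff (γ'.mapDomain (Sigma.mk j) + ρ) (expand (q b) (M a) g) := by
    intro b hb γ'
    rw [ho b hb, ← translate_expand, ← hH]
    · congr 2
      congr 1
      funext t
      simp
    · intro s hs
      rw [hrange] at hs
      rw [Pi.single_eq_of_ne hs]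
      rfl
  refine ⟨H, ?_, ?_, ?_⟩
  · refine Finset.sup_le fun γ' hγ' => ?_
    have h1 := hH 0 (fun _ _ => rfl) γ'
    rw [show (0 : (Σ j, κ j) → F) ∘ Sigma.mk j = 0 from rfl, translate_zero, translate_zero] at h1
    rw [mem_support_iff, h1] at hγ'
    have h2 := (degree_le_totalDegree_of_coeff_ne_zero hγ').trans
      ((totalDegree_expand_le _ _ _).trans hgD)
    rw [hdeg] at h2
    have h3 : (γ'.sum fun _ e => e) = γ'.degree := rfl
    omega
  · rw [hHb a (hS j a), ← hsplit]
    exact hm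
  · intro b hb γ' hlt
    rw [hHb b hb]
    rw [priority_lt_iff] at hlt
    have hd := hdeg γ'
    set m' := γ'.mapDomain (Sigma.mk j) + ρ with hm'
    by_cases hbT : b ∈ T
    · by_cases hba : b = a
      · subst hba
        refine hmin' b hbT m' ?_
        simp only [key, Prod.Lex.toLex_lt_toLex, lt_irrefl, false_or, true_and]
        rcases hlt with hlt | ⟨heq, hlt | ⟨-, hlt⟩⟩
        · left; omega
        · exact absurd hlt (lt_irrefl _)
        · right
          refine ⟨by omega, ?_⟩
          rw [hm', hupd γ']
          have : (fun i => toLex (Function.update (Finsupp.sigmaFinsuppEquivPiFinsupp m) j γ' i)) =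
              Function.update (fun i => toLex (Finsupp.sigmaFinsuppEquivPiFinsupp m i)) j
                (toLex γ') := by
            funext i
            by_cases hi : i = j
            · subst hi; simp
            · simp [hi]
          rw [this, Pi.toLex_update_lt_self_iff]
          exact hlt
      · have h1 : expand (q b) (M b) g ∈ idealOfVars (Σ j, κ j) F ^ (m'.degree + 1) := by
          rw [mem_pow_idealOfVars_iff']
          intro x hx
          refine hmin' b hbT x ?_
          simp only [key, Prod.Lex.toLex_lt_toLex]
          rcases hlt with hlt | ⟨heq, hlt | ⟨hlt, -⟩⟩
          · left; omega
          · rcases (show (x.degree : ℤ) - α b ≤ m.degree - α a by omega).lt_or_eq with h | h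
            · exact Or.inl h
            · exact Or.inr ⟨h, Or.inl hlt⟩
          · exact absurd hlt hba
        have h2 := expand_mem_pow_of_right_inverse (hMB b) h1 (M a)
        rw [mem_pow_idealOfVars_iff'] at h2
        exact h2 m' (Nat.lt_succ_self _)
    · have := hdom a haT b hbT
      omega

/-- The number of conditions at the points of a dominating set is at least the dimension of a
space of polynomials. -/
lemma pow_le_sum_prod_ncard_chosen (q : ι → σ → F) (M : ι → Matrix σ (Σ j, κ j) F)
    (B : ι → Matrix (Σ j, κ j) σ F) (hMB : ∀ a, M a * B a = 1)
    (y : ∀ j, ι → κ j → F) (S : J → ι → Set ι) (hS : ∀ j a, a ∈ S j a)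
    (hq : ∀ j a, ∃ o : σ → F, ∀ b ∈ S j a,
      q b = o + (M a).mulVec fun s => Pi.single (M := fun j => κ j → F) j (y j b) s.1 s.2)
    (α : ι → ℕ) (D : ℕ) (T : Finset ι) (hT : T.Nonempty)
    (hdom : ∀ a ∈ T, ∀ b ∉ T, α b + Fintype.card σ * D < α a) :
    (D + 1) ^ Fintype.card σ ≤
      ∑ a ∈ T, ∏ j, (chosen (S j a) (y j) α (Fintype.card σ * D) a).ncard := by
  classical
  set D₁ := Fintype.card σ * D
  let I : Finset (Σ _ : ι, ∀ j, κ j →₀ ℕ) := T.sigma fun a =>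
    Fintype.piFinset fun j => (finite_chosen (S j a) (y j) α D₁ a).toFinset
  have hI : I.card = ∑ a ∈ T, ∏ j, (chosen (S j a) (y j) α D₁ a).ncard := by
    rw [Finset.card_sigma]
    refine Finset.sum_congr rfl fun a _ => ?_
    rw [Fintype.card_piFinset]
    exact Finset.prod_congr rfl fun j _ => (Set.ncard_eq_toFinset_card _ _).symm
  rw [← hI]
  let Ψ : restrictDegree σ F D →ₗ[F] (I → F) := LinearMap.pi fun e =>
    (lcoeff F (Finsupp.sigmaFinsuppEquivPiFinsupp.symm e.1.2)).comp
      ((expand (q e.1.1) (M e.1.1)).toLinearMap.comp (Submodule.subtype _))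
  have hΨ : Function.Injective Ψ := by
    rw [← LinearMap.ker_eq_bot, LinearMap.ker_eq_bot']
    rintro ⟨g, hgD⟩ hg
    by_contra hne
    have hg0 : g ≠ 0 := fun h => hne (Subtype.ext h)
    have hdeg : g.totalDegree ≤ D₁ := by
      refine Finset.sup_le fun m hm => ?_
      rw [mem_restrictDegree] at hgD
      rw [Finsupp.sum_fintype _ _ (fun _ => rfl)]
      exact (Finset.sum_le_card_nsmul _ _ D fun i _ => hgD m hm i).trans (by simp [D₁])
    obtain ⟨a, haT, m, hm, hch⟩ := exists_coeff_ne_zero_of_chosen q M B hMB y S hS hq α D₁ T hT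
      hdom g hg0 hdeg
    have hmem : (⟨a, Finsupp.sigmaFinsuppEquivPiFinsupp m⟩ : Σ _ : ι, ∀ j, κ j →₀ ℕ) ∈ I := by
      simp only [I, Finset.mem_sigma, Fintype.mem_piFinset, Set.Finite.mem_toFinset]
      exact ⟨haT, hch⟩
    have h1 := congrFun hg ⟨_, hmem⟩
    simp only [Ψ, LinearMap.pi_apply, LinearMap.comp_apply, Submodule.subtype_apply,
      AlgHom.toLinearMap_apply, Equiv.symm_apply_apply, Pi.zero_apply] at h1
    exact hm h1
  have h1 := LinearMap.finrank_le_finrank_of_injective hΨ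
  have h2 : Module.finrank F (restrictDegree σ F D) = (D + 1) ^ Fintype.card σ := by
    rw [← ncard_setOf_forall_le, restrictDegree,
      Module.finrank_eq_nat_card_basis (basisRestrictSupport F _)]
    rfl
  rwa [h2, Module.finrank_fintype_fun_eq_card, Fintype.card_coe] at h1

end Vanishing

section Balancing

/-- If the weights `W α a` decrease when handicaps of other points are raised, react to raising the
handicap of `a` in a controlled way, and have large sum over any dominating set, then some choice
of the handicaps makes all weights large. -/
lemma exists_forall_le_card_mul {ι : Type*} [Fintype ι] [DecidableEq ι] (D Z : ℕ)
    (W W' : (ι → ℕ) → ι → ℕ)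
    (hmono : ∀ α β a, α ≤ β → α a = β a → W β a ≤ W α a)
    (hbump : ∀ α a, W (Function.update α a (α a + 1)) a ≤ W' α a)
    (hsum : ∀ (α : ι → ℕ) (T : Finset ι), T.Nonempty → (∀ a ∈ T, ∀ b ∉ T, α b + D < α a) →
      Z ≤ ∑ a ∈ T, W α a) :
    ∃ α : ι → ℕ, ∀ a, Z ≤ Fintype.card ι * W' α a := by
  classical
  set N := Fintype.card ι with hN
  set M := N * (D + 1) with hM
  let A : Finset (ι → ℕ) := (Fintype.piFinset fun _ => Finset.range (M + 1)).filter
    fun α => ∀ a, 0 < α a → N * W α a < Z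
  have hA : ∀ α, α ∈ A ↔ (∀ a, α a ≤ M) ∧ ∀ a, 0 < α a → N * W α a < Z := fun α => by
    simp [A]
  obtain ⟨α, hα, hmax⟩ := A.exists_max_image (fun α => ∑ a, α a)
    ⟨0, (hA 0).2 ⟨fun a => Nat.zero_le _, fun a h => absurd h (lt_irrefl _)⟩⟩
  obtain ⟨hαM, hαW⟩ := (hA α).1 hα
  refine ⟨α, fun a₀ => ?_⟩
  by_contra! hcon
  have ha₀ : α a₀ = M := by
    by_contra hne
    have hlt : α a₀ < M := lt_of_le_of_ne (hαM a₀) hne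
    set β := Function.update α a₀ (α a₀ + 1) with hβ
    have hle : α ≤ β := by
      rw [hβ, le_update_self_iff]
      exact Nat.le_succ _
    have hβA : β ∈ A := by
      rw [hA]
      refine ⟨fun a => ?_, fun a ha => ?_⟩
      · by_cases h : a = a₀
        · subst h; simpa [hβ] using hlt
        · simpa [hβ, h] using hαM a
      · by_cases h : a = a₀
        · subst h
          exact (Nat.mul_le_mul_left N (hbump α a)).trans_lt hcon
        · have haβ : α a = β a := by simp [hβ, h]
          exact (Nat.mul_le_mul_left N (hmono α β a hle haβ)).trans_lt (hαW a (haβ ▸ ha))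
    refine (hmax β hβA).not_gt (Finset.sum_lt_sum (fun a _ => hle a) ⟨a₀, Finset.mem_univ _, ?_⟩)
    simp [hβ]
  obtain ⟨m, hmN, hm⟩ : ∃ m < N, ∀ a, α a / (D + 1) ≠ m := by
    by_contra! h
    have hsub : Finset.range (N + 1) ⊆ Finset.univ.image fun a => α a / (D + 1) := by
      intro m hm
      rw [Finset.mem_image]
      rcases (Nat.lt_succ_iff.1 (Finset.mem_range.1 hm)).lt_or_eq with h1 | h1
      · obtain ⟨a, ha⟩ := h m h1
        exact ⟨a, Finset.mem_univ _, ha⟩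
      · refine ⟨a₀, Finset.mem_univ _, ?_⟩
        simp only [ha₀, hM, h1]
        exact Nat.mul_div_cancel _ (Nat.succ_pos _)
    have := (Finset.card_le_card hsub).trans Finset.card_image_le
    rw [Finset.card_range, Finset.card_univ] at this
    omega
  let T : Finset ι := Finset.univ.filter fun a => m < α a / (D + 1)
  have hTa₀ : a₀ ∈ T := by
    simp only [T, Finset.mem_filter, Finset.mem_univ, true_and, ha₀, hM]
    rwa [Nat.mul_div_cancel _ (Nat.succ_pos _)]
  have hTge : ∀ a ∈ T, (m + 1) * (D + 1) ≤ α a := fun a ha => by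
    simp only [T, Finset.mem_filter, Finset.mem_univ, true_and] at ha
    exact (Nat.le_div_iff_mul_le (Nat.succ_pos _)).1 ha
  have hZ := hsum α T ⟨a₀, hTa₀⟩ (fun a ha b hb => by
    have h1 := hTge a ha
    simp only [T, Finset.mem_filter, Finset.mem_univ, true_and, not_lt] at hb
    have h2 : α b < m * (D + 1) := (Nat.div_lt_iff_lt_mul (Nat.succ_pos _)).1
      (lt_of_le_of_ne hb (hm b))
    rw [Nat.succ_mul] at h1
    omega)
  have h1 : ∑ a ∈ T, N * W α a < ∑ _a ∈ T, Z :=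
    Finset.sum_lt_sum_of_nonempty ⟨a₀, hTa₀⟩ fun a ha =>
      hαW a (lt_of_lt_of_le (Nat.mul_pos (Nat.succ_pos _) (Nat.succ_pos _)) (hTge a ha))
  rw [← Finset.mul_sum, Finset.sum_const, smul_eq_mul] at h1
  have h2 : T.card * Z ≤ N * Z := Nat.mul_le_mul_right _ (Finset.card_le_univ T)
  exact absurd (h1.trans_le h2) (not_lt.2 (Nat.mul_le_mul_left _ hZ))

/-- A consequence of Hölder's inequality. -/
lemma card_pow_mul_le_prod {ι J : Type*} [Fintype ι] [Fintype J] [Nonempty J] (x : ι → J → ℝ)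
    (hx : ∀ a j, 0 ≤ x a j) (A : J → ℝ) (hA : ∀ j, 0 < A j) (hxA : ∀ j, ∑ a, x a j ≤ A j)
    (w : ℝ) (hw : 0 ≤ w) (hxw : ∀ a, w ≤ ∏ j, x a j) :
    (Fintype.card ι : ℝ) ^ Fintype.card J * w ≤ ∏ j, A j := by
  set d : ℝ := (Fintype.card J : ℝ) with hd
  have hd0 : 0 < d := by rw [hd]; exact_mod_cast Fintype.card_pos
  have hPA : 0 < ∏ j, A j := Finset.prod_pos fun j _ => hA j
  set c : ℝ := (w / ∏ j, A j) ^ d⁻¹ with hc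
  have hc0 : 0 ≤ c := Real.rpow_nonneg (div_nonneg hw hPA.le) _
  have hcd : c ^ Fintype.card J = w / ∏ j, A j := by
    rw [hc, hd]
    exact Real.rpow_inv_natCast_pow (div_nonneg hw hPA.le) Fintype.card_ne_zero
  have hamgm : ∀ a, c ≤ (∑ j, x a j / A j) / d := by
    intro a
    have h := Real.geom_mean_le_arith_mean Finset.univ (fun _ : J => (1 : ℝ))
      (fun j => x a j / A j) (fun _ _ => zero_le_one) (by simpa using Fintype.card_pos)
      (fun j _ => div_nonneg (hx a j) (hA j).le)
    simp only [Real.rpow_one, one_mul, Finset.sum_const, Finset.card_univ, nsmul_eq_mul,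
      mul_one] at h
    refine le_trans ?_ h
    rw [Finset.prod_div_distrib]
    exact Real.rpow_le_rpow (div_nonneg hw hPA.le)
      (div_le_div_of_nonneg_right (hxw a) hPA.le) (inv_nonneg.2 hd0.le)
  have hNc : (Fintype.card ι : ℝ) * c ≤ 1 := by
    calc (Fintype.card ι : ℝ) * c = ∑ _a : ι, c := by simp
      _ ≤ ∑ a, (∑ j, x a j / A j) / d := Finset.sum_le_sum fun a _ => hamgm a
      _ = (∑ j, (∑ a, x a j) / A j) / d := by
          rw [← Finset.sum_div, Finset.sum_comm]
          simp only [Finset.sum_div]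
      _ ≤ (∑ _j : J, 1) / d := by
          refine div_le_div_of_nonneg_right (Finset.sum_le_sum fun j _ => ?_) hd0.le
          exact (div_le_one (hA j)).2 (hxA j)
      _ = 1 := by simp [hd]
  have h := pow_le_one₀ (n := Fintype.card J) (mul_nonneg (Nat.cast_nonneg _) hc0) hNc
  rwa [mul_pow, hcd, ← mul_div_assoc, div_le_one hPA] at h

end Balancing

section Counting
variable {F : Type*} [Field F]

lemma exists_frame {n k : ℕ} (A : AffineSubspace F (Fin n → F))
    (hA : (A : Set (Fin n → F)).Nonempty) (hk : Module.finrank F A.direction = k) :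
    ∃ (o : Fin n → F) (b : Fin k → Fin n → F), Submodule.span F (Set.range b) = A.direction ∧
      ∀ p ∈ A, ∃ y : Fin k → F, p = o + ∑ t, y t • b t := by
  obtain ⟨o, ho⟩ := hA
  let e : Module.Basis (Fin k) F A.direction := Module.finBasisOfFinrankEq F A.direction hk
  refine ⟨o, fun t => (e t : Fin n → F), ?_, fun p hp => ?_⟩
  · have : Set.range (fun t => (e t : Fin n → F)) = A.direction.subtype '' Set.range e := by
      rw [← Set.range_comp]; rfl
    rw [this, Submodule.span_image, e.span_eq, Submodule.map_top, Submodule.range_subtype]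
  · refine ⟨e.repr ⟨p -ᵥ o, A.vsub_mem_direction hp ho⟩, ?_⟩
    have h := congrArg Subtype.val (e.sum_repr ⟨p -ᵥ o, A.vsub_mem_direction hp ho⟩)
    rw [AddSubmonoidClass.coe_finsetSum] at h
    simp only [Submodule.coe_smul] at h
    rw [h]
    simp

/-- The multijoint inequality for a finite indexed family of multijoints. -/
lemma pow_card_le_of_multijoints {n d N : ℕ} (k : Fin d → ℕ) (hd : 0 < d) (hk : ∑ j, k j = n)
    (hN : 0 < N) (P : (j : Fin d) → Finset (AffineSubspace F (Fin n → F)))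
    (hP : ∀ j, ∀ π ∈ P j,
      (π : Set (Fin n → F)).Nonempty ∧ Module.finrank F π.direction = k j)
    (q : Fin N → Fin n → F) (hq : Function.Injective q)
    (hJ : ∀ a, ∃ π : (j : Fin d) → AffineSubspace F (Fin n → F),
      (∀ j, π j ∈ P j) ∧ (∀ j, q a ∈ π j) ∧ (⨆ j, (π j).direction) = ⊤) :
    (N : ℝ) ^ (d - 1) ≤ ((n + 1) ^ n : ℕ) * ∏ j, ((P j).card : ℝ) := by
  classical
  have : Nonempty (Fin d) := ⟨⟨0, hd⟩⟩
  choose o b hspan hcoord using fun (j : Fin d) (A : {A // A ∈ P j}) =>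
    exists_frame A.1 (hP j A.1 A.2).1 (hP j A.1 A.2).2
  choose π₀ hπP hπq hπtop using hJ
  let π : ∀ j, Fin N → {A // A ∈ P j} := fun j a => ⟨π₀ a j, hπP a j⟩
  choose y hy using fun j a => hcoord j (π j a) (q a) (hπq a j)
  let M : Fin N → Matrix (Fin n) (Σ j, Fin (k j)) F := fun a =>
    Matrix.of fun i s => b s.1 (π s.1 a) s.2 i
  let S : Fin d → Fin N → Set (Fin N) := fun j a => {c | π j c = π j a}
  have hM : ∀ a, ∃ B : Matrix (Σ j, Fin (k j)) (Fin n) F, M a * B = 1 := by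
    intro a
    rw [← Matrix.mulVec_surjective_iff_exists_right_inverse]
    have h : LinearMap.range (M a).mulVecLin = ⊤ := by
      rw [Matrix.range_mulVecLin, eq_top_iff, ← hπtop a, iSup_le_iff]
      intro j
      rw [← hspan j (π j a)]
      refine Submodule.span_mono ?_
      rintro _ ⟨t, rfl⟩
      exact ⟨⟨j, t⟩, rfl⟩
    exact LinearMap.range_eq_top.1 h
  choose B hMB using hM
  have hframe : ∀ j a, ∃ o : Fin n → F, ∀ c ∈ S j a, q c = o + (M a).mulVec fun s =>
      Pi.single (M := fun j => Fin (k j) → F) j (y j c) s.1 s.2 := by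
    intro j a
    refine ⟨o j (π j a), fun c hc => ?_⟩
    have hc' : π j c = π j a := hc
    rw [hy j c, hc']
    congr 1
    funext i
    simp only [Matrix.mulVec, dotProduct, Fintype.sum_sigma, Finset.sum_apply, Pi.smul_apply,
      smul_eq_mul]
    rw [Finset.sum_eq_single j]
    · simp [M, mul_comm]
    · intro i' _ hi'
      simp [hi']
    · simp
  have hinj : ∀ j a, (S j a).InjOn (y j) := by
    intro j a c hc c' hc' h
    apply hq
    have h1 : π j c = π j a := hc
    have h2 : π j c' = π j a := hc'
    rw [hy j c, hy j c', h, h1, h2]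
  obtain ⟨α, hα⟩ := exists_forall_le_card_mul (n * N) ((N + 1) ^ n)
    (fun α a => ∏ j, (chosen (S j a) (y j) α (n * N) a).ncard)
    (fun α a => ∏ j, (chosen (S j a) (y j) α (n * N + N) a).ncard)
    (fun α β a hle ha => Finset.prod_le_prod' fun j _ =>
      Set.ncard_le_ncard (chosen_subset_of_le hle ha) (finite_chosen _ _ _ _ _))
    (fun α a => Finset.prod_le_prod' fun j _ => by
      refine Set.ncard_le_ncard ?_ (finite_chosen _ _ _ _ _)
      simpa using chosen_update_subset (hinj j a) (α := α) (D := n * N) (a := a) rfl)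
    (fun α T hT hdom => by
      simpa using pow_le_sum_prod_ncard_chosen q M B hMB y S (fun _ _ => rfl) hframe α N T hT
        (by simpa using hdom))
  rw [Fintype.card_fin] at hα
  have hsum : ∀ j, ∑ a, (chosen (S j a) (y j) α (n * N + N) a).ncard ≤
      (P j).card * ((n + 1) * (N + 1)) ^ k j := by
    intro j
    rw [← Finset.sum_fiberwise Finset.univ (π j)]
    refine (Finset.sum_le_card_nsmul _ _ (((n + 1) * (N + 1)) ^ k j) fun A _ => ?_).trans
      (by simp)
    have h := sum_ncard_chosen_le (Finset.univ.filter fun a => π j a = A) (y j) α (n * N + N)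
    rw [Fintype.card_fin] at h
    refine le_trans (le_of_eq (Finset.sum_congr rfl fun a ha => ?_)) (h.trans
      (Nat.pow_le_pow_left (by nlinarith) _))
    have ha' : π j a = A := (Finset.mem_filter.1 ha).2
    congr 2
    ext c
    simp [S, ha']
  have hPpos : ∀ j, 0 < (P j).card := fun j => Finset.card_pos.2 ⟨_, hπP ⟨0, hN⟩ j⟩
  have hN' : (0 : ℝ) < N := by exact_mod_cast hN
  have hfin := card_pow_mul_le_prod
    (fun (a : Fin N) j => ((chosen (S j a) (y j) α (n * N + N) a).ncard : ℝ))
    (fun _ _ => Nat.cast_nonneg _)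
    (fun j => ((P j).card : ℝ) * (((n + 1) * (N + 1) : ℕ) : ℝ) ^ k j)
    (fun j => mul_pos (by exact_mod_cast hPpos j) (by positivity))
    (fun j => by exact_mod_cast hsum j) (((N + 1) ^ n : ℕ) / N) (by positivity)
    (fun a => by
      rw [div_le_iff₀' hN']
      exact_mod_cast hα a)
  rw [Fintype.card_fin, Fintype.card_fin, Finset.prod_mul_distrib, Finset.prod_pow_eq_pow_sum, hk,
    ← pow_sub_one_mul hd.ne'] at hfin
  have hZ : (0 : ℝ) < ((N + 1) ^ n : ℕ) := by positivity
  refine le_of_mul_le_mul_right ?_ hZ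
  calc (N : ℝ) ^ (d - 1) * ((N + 1) ^ n : ℕ)
      = (N : ℝ) ^ (d - 1) * N * (((N + 1) ^ n : ℕ) / N) := by field_simp
    _ ≤ _ := hfin
    _ = _ := by push_cast; rw [mul_pow]; ring

end Counting

end Multijoint

/-- **Multijoint counting bound.**
Let `d ≥ 2`, `n`, `k 0, …, k (d-1)` be positive integers with `∑ j, k j = n`, `F` a field, and
`P j` finite sets of affine `k j`-planes in `Fⁿ`. Let `J` be the set of multijoints, i.e. points
lying on planes `π j ∈ P j` whose directions together span `Fⁿ`. There is a constant `C = C(n)`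
such that `|J| ≤ C * ∏ j, |P j| ^ (1/(d-1))`. -/
theorem multijoint_counting (n : ℕ) (hn : 0 < n) :
    ∃ C : ℝ, 0 < C ∧
      ∀ (d : ℕ) (k : Fin d → ℕ), 2 ≤ d → (∀ j, 0 < k j) → (∑ j, k j) = n →
      ∀ (F : Type) [Field F]
        (P : (j : Fin d) → Finset (AffineSubspace F (Fin n → F))),
        (∀ j, ∀ π ∈ P j,
          (π : Set (Fin n → F)).Nonempty ∧ Module.finrank F π.direction = k j) →
        (({p : Fin n → F | ∃ π : (j : Fin d) → AffineSubspace F (Fin n → F),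
            (∀ j, π j ∈ P j) ∧ (∀ j, p ∈ π j) ∧ (⨆ j, (π j).direction) = ⊤}).ncard : ℝ)
          ≤ C * ∏ j, ((P j).card : ℝ) ^ (((d : ℝ) - 1)⁻¹) := by
  refine ⟨((n + 1) ^ n : ℕ), by positivity, ?_⟩
  intro d k hd _ hsum F _ P hP
  set J := {p : Fin n → F | ∃ π : (j : Fin d) → AffineSubspace F (Fin n → F),
    (∀ j, π j ∈ P j) ∧ (∀ j, p ∈ π j) ∧ (⨆ j, (π j).direction) = ⊤} with hJ
  have hprod : 0 ≤ ∏ j, ((P j).card : ℝ) ^ (((d : ℝ) - 1)⁻¹) :=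
    Finset.prod_nonneg fun j _ => Real.rpow_nonneg (Nat.cast_nonneg _) _
  rcases Nat.eq_zero_or_pos J.ncard with h0 | hpos
  · rw [h0, Nat.cast_zero]
    positivity
  have hfin : J.Finite := Set.finite_of_ncard_pos hpos
  have hcard : hfin.toFinset.card = J.ncard := (Set.ncard_eq_toFinset_card J hfin).symm
  let e := (hfin.toFinset.equivFinOfCardEq hcard).symm
  have h := Multijoint.pow_card_le_of_multijoints k (by omega) hsum hpos P hP
    (fun a => (e a : Fin n → F)) (Subtype.val_injective.comp e.injective)
    (fun a => hfin.mem_toFinset.1 (e a).2)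
  have hd1 : d - 1 ≠ 0 := by omega
  have hdc : ((d - 1 : ℕ) : ℝ) = (d : ℝ) - 1 := by
    rw [Nat.cast_sub (by omega), Nat.cast_one]
  have hone : (1 : ℝ) ≤ ((n + 1) ^ n : ℕ) := by
    exact_mod_cast Nat.one_le_pow _ _ (Nat.succ_pos n)
  calc (J.ncard : ℝ) = ((J.ncard : ℝ) ^ (d - 1)) ^ (((d : ℝ) - 1)⁻¹) := by
        rw [← hdc, Real.pow_rpow_inv_natCast (Nat.cast_nonneg _) hd1]
    _ ≤ (((n + 1) ^ n : ℕ) * ∏ j, ((P j).card : ℝ)) ^ (((d : ℝ) - 1)⁻¹) :=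
        Real.rpow_le_rpow (by positivity) h (by rw [← hdc]; positivity)
    _ = (((n + 1) ^ n : ℕ) : ℝ) ^ (((d : ℝ) - 1)⁻¹) *
          ∏ j, ((P j).card : ℝ) ^ (((d : ℝ) - 1)⁻¹) := by
        rw [Real.mul_rpow (by positivity) (Finset.prod_nonneg fun j _ => Nat.cast_nonneg _),
          Real.finsetProd_rpow _ _ fun j _ => Nat.cast_nonneg _]
    _ ≤ _ := by
        refine mul_le_mul_of_nonneg_right ?_ hprod
        refine Real.rpow_le_self_of_one_le hone ?_
        rw [← hdc]
        exact inv_le_one_of_one_le₀ (by exact_mod_cast Nat.one_le_iff_ne_zero.2 hd1)
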